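/- arXiv:1607.00965 — 3 statements merged into one kernel-verified Lean document; each statement's English description precedes it below -/
import Mathlib

section
/- For every odd prime p, every λ ≥ 1, and every finite abelian p-group P, there exists a finite local commutative ring A with A* ≅ F_{p^λ}* × P^λ. -/
open Polynomial

lemma aux_split {G H : Type*} [CommGroup G] [Finite G] [CommGroup H] (φ : G →* H)
    (hφ : Function.Surjective φ) (hc : Nat.Coprime (Nat.card φ.ker) (Nat.card H)) :
    Nonempty (G ≃* H × φ.ker) := by
  have e1 : G ⧸ φ.ker ≃* H := QuotientGroup.quotientKerEquivOfSurjective φ hφ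
  have hidx : φ.ker.index = Nat.card H := Nat.card_congr e1.toEquiv
  obtain ⟨K, hK⟩ := Subgroup.exists_right_complement'_of_coprime (N := φ.ker) (by rwa [hidx])
  have e2 : G ⧸ φ.ker ≃* K := hK.symm.QuotientMulEquiv
  have hb : Function.Bijective (φ.ker.subtype.coprod K.subtype) := hK
  have e3 : φ.ker × K ≃* G := MulEquiv.ofBijective _ hb
  exact ⟨e3.symm.trans (MulEquiv.prodComm.trans ((e2.symm.trans e1).prodCongr (MulEquiv.refl _)))⟩

lemma aux_tsze {R M : Type*} [CommRing R] [AddCommGroup M] [Module R M] [Module Rᵐᵒᵖ M]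
    [IsCentralScalar R M] :
    Nonempty ((TrivSqZeroExt R M)ˣ ≃* Rˣ × Multiplicative M) := by
  have hb : ∀ m : M, (1 + TrivSqZeroExt.inr m : TrivSqZeroExt R M) * (1 + TrivSqZeroExt.inr (-m)) = 1 := by
    intro m
    ext <;> simp
  let ψ : Multiplicative M →* (TrivSqZeroExt R M)ˣ :=
    { toFun := fun m => ⟨1 + TrivSqZeroExt.inr m.toAdd, 1 + TrivSqZeroExt.inr (-m.toAdd), hb _,
        by rw [mul_comm]; exact hb _⟩
      map_one' := by ext <;> simp
      map_mul' := fun a b => by ext <;> simp [add_comm] }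
  let Φ : Rˣ × Multiplicative M →* (TrivSqZeroExt R M)ˣ :=
    (Units.map (TrivSqZeroExt.inlHom R M).toMonoidHom).coprod ψ
  have h1 : ∀ u m, ((Φ (u, m) : (TrivSqZeroExt R M)ˣ) : TrivSqZeroExt R M).fst = u := by
    intro u m; simp [Φ, ψ]
  have h2 : ∀ u m, ((Φ (u, m) : (TrivSqZeroExt R M)ˣ) : TrivSqZeroExt R M).snd = (u : R) • m.toAdd := by
    intro u m; simp [Φ, ψ]
  refine ⟨(MulEquiv.ofBijective Φ ⟨?_, ?_⟩).symm⟩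
  · rw [injective_iff_map_eq_one]
    rintro ⟨u, m⟩ h
    have a := h1 u m
    have b := h2 u m
    rw [h] at a b
    have hu : u = 1 := by ext; simpa using a.symm
    subst hu
    have : m.toAdd = 0 := by simpa using b.symm
    ext <;> simp_all
  · intro x
    let u : Rˣ := Units.map (TrivSqZeroExt.fstHom R R M).toMonoidHom x
    have hu : (u : R) = (x : TrivSqZeroExt R M).fst := rfl
    refine ⟨(u, Multiplicative.ofAdd ((↑u⁻¹ : R) • (x : TrivSqZeroExt R M).snd)), ?_⟩
    ext
    · rw [h1, hu]
    · rw [h2]; simp [smul_smul]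

lemma aux_P (p : ℕ) [Fact p.Prime] (P : Type*) [CommGroup P] [Finite P] (hP : IsPGroup p P) :
    ∃ (a : ℕ) (κ : Type) (_ : Fintype κ) (b : κ → ℕ), (∀ k, b k ≤ a) ∧
      Nonempty (P ≃* Multiplicative (ZMod (p ^ a)) × (∀ k, Multiplicative (ZMod (p ^ b k)))) := by
  obtain ⟨ι, _, n, hn, ⟨e⟩⟩ := CommGroup.equiv_prod_multiplicative_zmod_of_finite P
  classical
  have hpow : ∀ i, ∃ k, n i = p ^ k := by
    intro i
    have : NeZero (n i) := NeZero.of_gt (hn i)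
    have hs : Function.Surjective ((Pi.evalMonoidHom (fun i => Multiplicative (ZMod (n i))) i).comp
        e.toMonoidHom) := (Function.surjective_eval i).comp e.surjective
    have := hP.of_surjective _ hs
    have hh := IsPGroup.iff_card.1 this
    simpa using hh
  choose b hb using hpow
  obtain rfl : n = fun i => p ^ b i := funext hb
  rcases isEmpty_or_nonempty ι with h | h
  · refine ⟨0, ι, inferInstance, b, fun k => h.elim k, ⟨e.trans ?_⟩⟩
    have : Unique (Multiplicative (ZMod (p ^ 0))) :=
      (Multiplicative.toAdd.trans (ZMod.ringEquivCongr (pow_zero p)).toEquiv).unique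
    exact MulEquiv.uniqueProd.symm
  · obtain ⟨i0, h0⟩ := Finite.exists_max b
    refine ⟨b i0, {j // j ≠ i0}, inferInstance, fun k => b k, fun k => h0 _, ⟨e.trans ?_⟩⟩
    exact { Equiv.piSplitAt i0 _ with map_mul' := fun x y => rfl }

lemma aux_rings (p : ℕ) [Fact p.Prime] (lam : ℕ) (hlam : 1 ≤ lam) :
    ∃ (R : ℕ → Type) (_ : ∀ n, CommRing (R n)),
      (∀ n, Nonempty (R n ≃+ (Fin lam → ZMod (p ^ n)))) ∧
      (∀ m n, m ≤ n → Nonempty (R n →+* R m)) ∧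
      (∀ n, ∃ π : R (n+1) →+* GaloisField p lam, Function.Surjective π ∧
        ∀ x, π x = 0 → (p : R (n+1)) ∣ x) := by
  obtain ⟨α, hα⟩ := Field.exists_primitive_element (ZMod p) (GaloisField p lam)
  have hdeg := (Field.primitive_element_iff_minpoly_natDegree_eq _ α).1 hα
  rw [GaloisField.finrank p (by omega)] at hdeg
  have hint : IsIntegral (ZMod p) α := IsIntegral.of_finite _ _
  have hlift : ∀ g : (ZMod p)[X], ∃ q : ℤ[X], q.map (Int.castRingHom (ZMod p)) = g := fun g =>
    Polynomial.map_surjective _ ZMod.intCast_surjective g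
  obtain ⟨f, hf1, hf2, hf3⟩ := lifts_and_natDegree_eq_and_monic (f := Int.castRingHom (ZMod p))
    (by rw [Polynomial.mem_lifts]; exact hlift _) (minpoly.monic hint)
  rw [hdeg] at hf2
  refine ⟨fun n => AdjoinRoot (f.map (Int.castRingHom (ZMod (p ^ n)))), fun n => inferInstance, ?_, ?_, ?_⟩
  · intro n
    let B := (AdjoinRoot.powerBasisAux' (hf3.map (Int.castRingHom (ZMod (p ^ n)))))
    rcases n with _ | n
    · have h1 : Subsingleton (ZMod (p ^ 0)) :=
        (ZMod.ringEquivCongr (pow_zero p)).toEquiv.subsingleton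
      have h2 : Subsingleton (AdjoinRoot (f.map (Int.castRingHom (ZMod (p ^ 0))))) :=
        B.equivFun.toEquiv.subsingleton
      exact ⟨⟨⟨fun _ => 0, fun _ => (0 : AdjoinRoot (f.map (Int.castRingHom (ZMod (p ^ 0))))),
        fun _ => h2.elim _ _, fun _ => Subsingleton.elim _ _⟩, fun _ _ => Subsingleton.elim _ _⟩⟩
    · have : Fact (1 < p ^ (n+1)) := ⟨Nat.one_lt_pow (by omega) (Fact.out : p.Prime).one_lt⟩
      have hd : (f.map (Int.castRingHom (ZMod (p ^ (n+1))))).natDegree = lam := by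
        rw [hf3.natDegree_map, hf2]
      exact ⟨(B.reindex (finCongr hd)).equivFun.toAddEquiv⟩
  · intro m n hmn
    exact ⟨AdjoinRoot.map (ZMod.castHom (pow_dvd_pow p hmn) (ZMod (p ^ m))) _ _ (by
      rw [Polynomial.map_map]
      rw [RingHom.ext_int ((ZMod.castHom (pow_dvd_pow p hmn) (ZMod (p ^ m))).comp (Int.castRingHom (ZMod (p ^ n)))) (Int.castRingHom (ZMod (p ^ m)))])⟩
  · intro n
    let c : ZMod (p ^ (n+1)) →+* GaloisField p lam :=
      (algebraMap (ZMod p) _).comp (ZMod.castHom (dvd_pow_self p (by omega)) (ZMod p))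
    have hc : ∀ g : ℤ[X], (g.map (Int.castRingHom (ZMod (p ^ (n+1))))).eval₂ c α =
        aeval α (g.map (Int.castRingHom (ZMod p))) := by
      intro g
      rw [Polynomial.eval₂_map, Polynomial.aeval_def, Polynomial.eval₂_map]
      congr 1
      exact RingHom.ext_int _ _
    refine ⟨AdjoinRoot.lift c α ?_, ?_, ?_⟩
    · rw [hc, hf1, minpoly.aeval]
    · intro y
      have hy : y ∈ Algebra.adjoin (ZMod p) {α} := by
        rw [← IntermediateField.adjoin_simple_toSubalgebra_of_isAlgebraic hint.isAlgebraic, hα]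
        trivial
      rw [Algebra.adjoin_singleton_eq_range_aeval] at hy
      obtain ⟨g, hg⟩ := hy
      obtain ⟨q, rfl⟩ := hlift g
      refine ⟨AdjoinRoot.mk _ (q.map (Int.castRingHom (ZMod (p ^ (n+1))))), ?_⟩
      rw [AdjoinRoot.lift_mk, hc]
      exact hg
    · intro x hx
      obtain ⟨g, rfl⟩ := AdjoinRoot.mk_surjective x
      obtain ⟨g, rfl⟩ := Polynomial.map_surjective (Int.castRingHom (ZMod (p ^ (n+1)))) ZMod.intCast_surjective g
      rw [AdjoinRoot.lift_mk, hc] at hx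
      obtain ⟨q, hq⟩ := minpoly.dvd _ _ hx
      obtain ⟨q, rfl⟩ := hlift q
      rw [← hf1, ← Polynomial.map_mul, ← sub_eq_zero, ← Polynomial.map_sub] at hq
      have hd : C (p : ℤ) ∣ g - f * q := by
        rw [Polynomial.C_dvd_iff_dvd_coeff]
        intro i
        rw [← ZMod.intCast_zmod_eq_zero_iff_dvd]
        have := congrArg (fun r => r.coeff i) hq
        simpa only [coeff_map, coeff_zero, eq_intCast] using this
      obtain ⟨r, hr⟩ := hd
      refine ⟨AdjoinRoot.mk _ (r.map (Int.castRingHom (ZMod (p ^ (n+1))))), ?_⟩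
      rw [sub_eq_iff_eq_add] at hr
      rw [hr]
      simp

lemma aux_core (p : ℕ) [hp : Fact p.Prime] (hodd : p ≠ 2) (lam a : ℕ) {R F : Type*} [CommRing R]
    [Field F] (hF : Nat.card F = p ^ lam) (e : R ≃+ (Fin lam → ZMod (p ^ (a + 1))))
    (π : R →+* F) (hπ : Function.Surjective π) (hker : ∀ x, π x = 0 → (p : R) ∣ x) :
    IsLocalRing R ∧ Nonempty (Rˣ ≃* Fˣ × (Fin lam → Multiplicative (ZMod (p ^ a)))) := by
  have hN : NeZero (p ^ (a + 1)) := ⟨pow_ne_zero _ hp.out.ne_zero⟩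
  have hN' : NeZero (p ^ a) := ⟨pow_ne_zero _ hp.out.ne_zero⟩
  have hfinR : Finite R := Finite.of_equiv _ e.symm.toEquiv
  have hfinF : Finite F := Nat.finite_of_card_ne_zero (by rw [hF]; exact pow_ne_zero _ hp.out.ne_zero)
  have hcardR : Nat.card R = p ^ ((a + 1) * lam) := by
    rw [Nat.card_congr e.toEquiv]; simp [pow_mul]
  -- `p` is nilpotent
  have hnil : (p : R) ^ (a + 1) = 0 := by
    apply e.injective
    have : (p : R) ^ (a + 1) = (p ^ (a + 1)) • (1 : R) := by simp
    rw [this, map_nsmul, map_zero]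
    funext i
    simp only [Pi.smul_apply, nsmul_eq_mul, Pi.zero_apply]
    rw [ZMod.natCast_self, zero_mul]
  have hpF : (π (p : R)) = 0 := by
    have : (π (p : R)) ^ (a + 1) = 0 := by rw [← map_pow, hnil, map_zero]
    exact pow_eq_zero_iff (by omega) |>.1 this
  have hloc : IsLocalHom π := by
    refine ⟨fun x hx => ?_⟩
    obtain ⟨y, hy⟩ := hπ (π x)⁻¹
    have : π (x * y - 1) = 0 := by
      rw [map_sub, map_mul, hy, mul_inv_cancel₀ hx.ne_zero, map_one, sub_self]
    obtain ⟨z, hz⟩ := hker _ this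
    have hn : IsNilpotent (x * y - 1) := ⟨a + 1, by rw [hz, mul_pow, hnil, zero_mul]⟩
    have := hn.isUnit_add_one
    rw [sub_add_cancel] at this
    exact isUnit_of_mul_isUnit_left this
  refine ⟨π.domain_isLocalRing, ?_⟩
  let φ : Rˣ →* Fˣ := Units.map π.toMonoidHom
  have hφ : Function.Surjective φ := by
    intro u
    obtain ⟨x, hx⟩ := hπ u
    have hu : IsUnit x := isUnit_of_map_unit π x (hx ▸ u.isUnit)
    exact ⟨hu.unit, by ext; simpa [φ] using hx⟩
  have hmem : ∀ u : Rˣ, u ∈ φ.ker ↔ π (u : R) = 1 := by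
    intro u
    rw [MonoidHom.mem_ker, Units.ext_iff]; rfl
  -- cardinality of the kernel
  have hcard : Nat.card φ.ker = p ^ (a * lam) := by
    have h1 : Nat.card φ.ker = Nat.card π.toAddMonoidHom.ker := by
      refine Nat.card_congr (Equiv.ofBijective
        (fun u => ⟨((u : Rˣ) : R) - 1, ?_⟩) ⟨?_, ?_⟩)
      · have := (hmem _).1 u.2
        rw [AddMonoidHom.mem_ker]
        change π _ = 0
        rw [map_sub, this, map_one, sub_self]
      · intro u v h
        exact Subtype.ext (Units.ext (sub_left_injective (congrArg Subtype.val h)))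
      · rintro ⟨x, hx⟩
        have hx : π x = 0 := hx
        have h2 : π (x + 1) = 1 := by rw [map_add, hx, map_one, zero_add]
        have hu : IsUnit (x + 1) := isUnit_of_map_unit π _ (by rw [h2]; exact isUnit_one)
        exact ⟨⟨hu.unit, (hmem _).2 h2⟩, by simp⟩
    have h2 := AddSubgroup.card_eq_card_quotient_mul_card_addSubgroup π.toAddMonoidHom.ker
    rw [Nat.card_congr (QuotientAddGroup.quotientKerEquivOfSurjective π.toAddMonoidHom hπ).toEquiv,
      hF, hcardR, ← h1, add_mul, one_mul, add_comm, pow_add] at h2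
    exact (Nat.eq_of_mul_eq_mul_left (pow_pos hp.out.pos _) h2).symm
  have hcop : Nat.Coprime (Nat.card φ.ker) (Nat.card Fˣ) := by
    rw [hcard]
    apply Nat.Coprime.pow_left
    rw [Nat.card_units, hF, hp.out.coprime_iff_not_dvd]
    intro hd
    have hl : lam ≠ 0 := by
      rintro rfl
      have := Finite.one_lt_card (α := F)
      rw [hF] at this
      simp at this
    have h3 : p ∣ p ^ lam := dvd_pow_self p hl
    have h4 := (Nat.dvd_sub_iff_right (Nat.one_le_pow _ _ hp.out.pos) h3).1 hd
    exact hp.out.one_lt.ne' (Nat.dvd_one.1 h4)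
  obtain ⟨E⟩ := aux_split φ hφ hcop
  -- generators
  let ε : Fin lam → R := fun i => e.symm (Pi.single i 1)
  have hπp : ∀ y : R, π (1 + p * y) = 1 := by
    intro y; rw [map_add, map_mul, hpF, zero_mul, map_one, add_zero]
  have hun : ∀ y : R, IsUnit (1 + p * y) := fun y =>
    isUnit_of_map_unit π _ (by rw [hπp]; exact isUnit_one)
  let g : Fin lam → φ.ker := fun i => ⟨(hun (ε i)).unit, (hmem _).2 (hπp _)⟩
  have hg : ∀ i, (((g i : φ.ker) : Rˣ) : R) = 1 + p * ε i := fun i => rfl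
  have hgp : ∀ i, g i ^ (p ^ a) = 1 := by
    intro i
    ext
    have := dvd_sub_pow_of_dvd_sub (p := p) (a := 1 + p * ε i) (b := 1) (by simp) a
    rw [hnil, zero_dvd_iff, one_pow, sub_eq_zero] at this
    simpa [hg] using this
  let ψ : (Fin lam → ZMod (p ^ a)) →+ Additive φ.ker :=
    ∑ i, (ZMod.lift (p ^ a) ⟨zmultiplesHom _ (Additive.ofMul (g i)), by
      rw [zmultiplesHom_apply, natCast_zsmul, ← ofMul_pow, hgp, ofMul_one]⟩).comp
        (Pi.evalAddMonoidHom _ i)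
  have hψ : ∀ i, Additive.ofMul (g i) ∈ ψ.range := by
    intro i
    refine ⟨Pi.single i 1, ?_⟩
    simp only [ψ, AddMonoidHom.finsetSum_apply]
    rw [Finset.sum_eq_single i]
    · have : (1 : ZMod (p ^ a)) = ((1 : ℤ) : ZMod (p ^ a)) := by simp
      simp only [AddMonoidHom.comp_apply, Pi.evalAddMonoidHom_apply, Pi.single_eq_same]
      rw [this, ZMod.lift_coe]
      simp
    · intro j _ hj
      simp [hj]
    · simp
  let H : Subgroup φ.ker := ψ.range.toSubgroup'
  have hgH : ∀ i, g i ∈ H := hψ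
  have key : ∀ j, j ≤ a → ∀ u : φ.ker, (p : R) ^ (a + 1 - j) ∣ ((u : Rˣ) : R) - 1 → u ∈ H := by
    intro j
    induction j with
    | zero =>
      intro _ u hu
      rw [Nat.sub_zero, hnil, zero_dvd_iff, sub_eq_zero] at hu
      have : u = 1 := by ext; simpa using hu
      rw [this]; exact one_mem _
    | succ j ih =>
      intro hj u hu
      obtain ⟨k, hk⟩ : ∃ k, a = j + 1 + k := ⟨a - (j + 1), by omega⟩
      have e1 : a + 1 - (j + 1) = k + 1 := by omega
      have e2 : a + 1 - j = k + 2 := by omega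
      rw [e1] at hu
      rw [e2] at ih
      obtain ⟨y, hy⟩ := hu
      let n : Fin lam → ℕ := fun i => (e y i).val
      have hyn : y = ∑ i, (n i : R) * ε i := by
        apply e.injective
        rw [map_sum]
        funext i
        rw [Finset.sum_apply, Finset.sum_eq_single i]
        · rw [← nsmul_eq_mul, map_nsmul]
          simp [ε, n]
        · intro l _ hl
          rw [← nsmul_eq_mul, map_nsmul]
          simp [ε, hl.symm]
        · simp
      let h : φ.ker := ∏ i, (g i ^ p ^ k) ^ n i
      have hhH : h ∈ H := Subgroup.prod_mem _ fun i _ => pow_mem (pow_mem (hgH i) _) _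
      let I : Ideal R := Ideal.span {(p : R) ^ (k + 2)}
      have hI : ∀ x y : R, Ideal.Quotient.mk I x = Ideal.Quotient.mk I y ↔ (p : R) ^ (k + 2) ∣ x - y := by
        intro x y
        rw [Ideal.Quotient.eq, Ideal.mem_span_singleton]
      have hgk : ∀ i, Ideal.Quotient.mk I ((1 + p * ε i) ^ p ^ k) =
          Ideal.Quotient.mk I (1 + p ^ (k + 1) * ε i) := by
        intro i
        obtain ⟨z, hz⟩ := ZMod.exists_one_add_mul_pow_prime_pow_eq (u := (p : R)) (v := p) hp.out
          dvd_rfl (by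
            have : (p : R) * p * p = p ^ 3 := by ring
            rw [this]
            apply pow_dvd_pow
            have := hp.out.two_le
            omega) (ε i) k
        rw [hI, hz]
        exact ⟨z, by ring⟩
      have hsq : ∀ (x : R) (m : ℕ), Ideal.Quotient.mk I ((1 + p ^ (k + 1) * x) ^ m) =
          Ideal.Quotient.mk I (1 + p ^ (k + 1) * (m * x)) := by
        intro x m
        induction m with
        | zero => simp
        | succ m ihm =>
          rw [pow_succ, map_mul, ihm, ← map_mul, hI]
          exact ⟨p ^ k * (m * x * x), by push_cast; ring⟩
      have hprod : ∀ s : Finset (Fin lam),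
          Ideal.Quotient.mk I (∏ i ∈ s, ((1 + p * ε i) ^ p ^ k) ^ n i) =
          Ideal.Quotient.mk I (1 + p ^ (k + 1) * ∑ i ∈ s, (n i : R) * ε i) := by
        intro s
        induction s using Finset.induction_on with
        | empty => simp
        | insert i s his ihs =>
          rw [Finset.prod_insert his, Finset.sum_insert his, map_mul, ihs, map_pow, hgk, ← map_pow,
            hsq, ← map_mul, hI]
          exact ⟨p ^ k * ((n i * ε i) * ∑ i ∈ s, (n i : R) * ε i), by ring⟩
      have hhval : ((h : Rˣ) : R) = ∏ i, ((1 + p * ε i) ^ p ^ k) ^ n i := by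
        simp [h, hg]
      have huh : (p : R) ^ (k + 2) ∣ ((u : Rˣ) : R) - ((h : Rˣ) : R) := by
        rw [← hI, hhval, hprod, ← hyn, ← hy]
        congr 1; ring
      have hdiv : u * h⁻¹ ∈ H := by
        apply ih (by omega)
        obtain ⟨w, hw⟩ := huh
        refine ⟨w * ((h⁻¹ : φ.ker) : Rˣ), ?_⟩
        rw [← mul_assoc, ← hw, sub_mul]
        simp
      have := mul_mem hdiv hhH
      simpa using this
  have hsurj : Function.Surjective ψ := by
    intro u
    have : u.toMul ∈ H := by
      apply key a le_rfl
      have : a + 1 - a = 1 := by omega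
      rw [this, pow_one]
      apply hker
      rw [map_sub, (hmem _).1 u.toMul.2, map_one, sub_self]
    exact this
  have hbij : Function.Bijective ψ := by
    apply (Nat.bijective_iff_surjective_and_card _).2 ⟨hsurj, ?_⟩
    have : Nat.card (Additive φ.ker) = Nat.card φ.ker := rfl
    rw [this, hcard]
    simp [pow_mul]
  let Ψ := AddEquiv.ofBijective ψ hbij
  let Ψ' : φ.ker ≃* (Fin lam → Multiplicative (ZMod (p ^ a))) :=
    { toFun := fun u i => Multiplicative.ofAdd (Ψ.symm (Additive.ofMul u) i)
      invFun := fun v => (Ψ fun i => (v i).toAdd).toMul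
      left_inv := fun u => Ψ.apply_symm_apply _
      right_inv := fun v => Ψ.symm_apply_apply _
      map_mul' := fun u v => by
        funext i
        simp [ofMul_mul, map_add] }
  exact ⟨E.trans ((MulEquiv.refl _).prodCongr Ψ')⟩

theorem stmt16 (p : ℕ) [Fact p.Prime] (hodd : p ≠ 2) (lam : ℕ) (hlam : 1 ≤ lam)
    (P : Type*) [CommGroup P] [Finite P] (hP : IsPGroup p P) :
    ∃ (A : Type) (_ : CommRing A) (_ : IsLocalRing A) (_ : Finite A),
      Nonempty (Aˣ ≃* (GaloisField p lam)ˣ × (Fin lam → P)) := by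
  obtain ⟨a, κ, _, b, hba, ⟨eP⟩⟩ := aux_P p P hP
  obtain ⟨R, _, hadd, hhom, hres⟩ := aux_rings p lam hlam
  obtain ⟨π, hπ, hker⟩ := hres a
  obtain ⟨e⟩ := hadd (a + 1)
  obtain ⟨hloc, ⟨E⟩⟩ := aux_core p hodd lam a (GaloisField.card p lam (by omega)) e π hπ hker
  have hhom' : ∀ k, Nonempty (R (a + 1) →+* R (b k)) := fun k =>
    hhom _ _ ((hba k).trans (Nat.le_succ _))
  let θ : ∀ k, R (a + 1) →+* R (b k) := fun k => (hhom' k).some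
  let M : Type := ∀ k, R (b k)
  let Θ : R (a + 1) →+* M := RingHom.pi θ
  let _ : AddCommGroup M := inferInstanceAs (AddCommGroup (∀ k, R (b k)))
  let _ : Module (R (a + 1)) M := Θ.toModule
  let _ : Module (R (a + 1))ᵐᵒᵖ M := Module.compHom M ((RingHom.id (R (a + 1))).fromOpposite fun _ _ => mul_comm _ _)
  have : IsCentralScalar (R (a + 1)) M := ⟨fun _ _ => rfl⟩
  have hne : ∀ n, NeZero (p ^ n) := fun n => ⟨pow_ne_zero _ (Fact.out : p.Prime).ne_zero⟩
  have hfin : ∀ n, Finite (R n) := fun n => Finite.of_equiv _ (hadd n).some.symm.toEquiv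
  have hfM : Finite M := inferInstanceAs (Finite (∀ k, R (b k)))
  have hl : IsLocalHom (TrivSqZeroExt.fstHom (R (a + 1)) (R (a + 1)) M).toRingHom :=
    ⟨fun x hx => TrivSqZeroExt.isUnit_iff_isUnit_fst.2 hx⟩
  obtain ⟨T⟩ := aux_tsze (R := R (a + 1)) (M := M)
  refine ⟨TrivSqZeroExt (R (a + 1)) M, inferInstance,
    (TrivSqZeroExt.fstHom (R (a + 1)) (R (a + 1)) M).toRingHom.domain_isLocalRing,
    inferInstanceAs (Finite (R (a + 1) × M)), ⟨T.trans ?_⟩⟩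
  let Z : ∀ k, R (b k) ≃+ (Fin lam → ZMod (p ^ b k)) := fun k => (hadd (b k)).some
  let Q : (Fin lam → Multiplicative (ZMod (p ^ a))) × Multiplicative M ≃* (Fin lam → P) :=
    { toFun := fun x i => eP.symm (x.1 i, fun k => Multiplicative.ofAdd (Z k (x.2.toAdd k) i))
      invFun := fun y => (fun i => (eP (y i)).1,
        Multiplicative.ofAdd fun k => (Z k).symm fun i => ((eP (y i)).2 k).toAdd)
      left_inv := fun x => by simp; rfl
      right_inv := fun y => by simp
      map_mul' := fun x y => by
        funext i
        rw [Pi.mul_apply, ← map_mul]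
        congr 1
        ext k
        · rfl
        · change Z k (x.2.toAdd k + y.2.toAdd k) i = Z k (x.2.toAdd k) i + Z k (y.2.toAdd k) i
          rw [map_add]; rfl }
  exact (E.prodCongr (MulEquiv.refl _)).trans (MulEquiv.prodAssoc.trans ((MulEquiv.refl _).prodCongr Q))
end

section
/- For every odd prime p and every finite abelian p-group P, there exists a finite commutative ring A with A* ≅ ℤ/(p−1)ℤ × P. -/
open TrivSqZeroExt in
/-- The map from units of the base times the module to the units of the extension. -/
noncomputable def tszUnitsHom (R M : Type) [CommRing R] [AddCommGroup M] [Module R M]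
    [Module Rᵐᵒᵖ M] [IsCentralScalar R M] :
    Rˣ × Multiplicative M →* (TrivSqZeroExt R M)ˣ :=
  MonoidHom.toHomUnits
    { toFun := fun x => inl (x.1 : R) + inr ((x.1 : R) • x.2.toAdd)
      map_one' := by ext <;> simp
      map_mul' := by
        intro x y
        ext
        · simp
        · simp [smul_smul, mul_comm, add_comm] }

open TrivSqZeroExt in
theorem tszUnits_bij (R M : Type) [CommRing R] [AddCommGroup M] [Module R M]
    [Module Rᵐᵒᵖ M] [IsCentralScalar R M] : Function.Bijective (tszUnitsHom R M) := by
  have hval : ∀ x, ((tszUnitsHom R M x : (TrivSqZeroExt R M)ˣ) : TrivSqZeroExt R M)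
      = inl (x.1 : R) + inr ((x.1 : R) • x.2.toAdd) := fun x => rfl
  constructor
  · rintro ⟨a, m⟩ ⟨b, k⟩ h
    have h' := congrArg Units.val h
    rw [hval, hval] at h'
    have h1 := congrArg fst h'
    have h2 := congrArg snd h'
    simp at h1 h2
    replace h1 : a = b := Units.ext h1
    subst h1
    have h3 := congrArg (fun z => ((a⁻¹ : Rˣ) : R) • z) h2
    simp [smul_smul] at h3
    simp [h3]
  · intro u
    refine ⟨(Units.map (fstHom R R M : TrivSqZeroExt R M →* R) u,
      Multiplicative.ofAdd ((((Units.map (fstHom R R M : TrivSqZeroExt R M →* R) u)⁻¹ : Rˣ) : R)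
        • (u : TrivSqZeroExt R M).snd)), ?_⟩
    apply Units.ext
    rw [hval]
    ext
    · simp
    · rw [toAdd_ofAdd, smul_smul, Units.mul_inv]
      simp

theorem zmod_units_equiv (p : ℕ) (hp : p.Prime) (hodd : p ≠ 2) (N : ℕ) :
    Nonempty ((ZMod (p ^ (N + 1)))ˣ ≃*
      Multiplicative (ZMod (p - 1)) × Multiplicative (ZMod (p ^ N))) := by
  have hcop : Nat.Coprime (p - 1) (p ^ N) := by
    apply Nat.Coprime.pow_right
    have := Nat.coprime_self_sub_left hp.one_lt.le
    rw [this]; simp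
  have := ZMod.isCyclic_units_of_prime_pow p hp hodd (N + 1)
  have : NeZero (p ^ (N + 1)) := ⟨pow_ne_zero _ hp.ne_zero⟩
  have e1 : (ZMod (p ^ (N + 1)))ˣ ≃* Multiplicative (ZMod ((p - 1) * p ^ N)) := by
    apply mulEquivOfCyclicCardEq
    rw [Nat.card_eq_fintype_card, ZMod.card_units_eq_totient, Nat.totient_prime_pow_succ hp]
    rw [mul_comm]; exact (Nat.card_zmod _).symm
  have e2 : Multiplicative (ZMod ((p - 1) * p ^ N)) ≃*
      Multiplicative (ZMod (p - 1) × ZMod (p ^ N)) :=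
    AddEquiv.toMultiplicative (ZMod.chineseRemainder hcop).toAddEquiv
  exact ⟨(e1.trans e2).trans (MulEquiv.prodMultiplicative _ _)⟩

theorem ring_of_module (p : ℕ) (hp : p.Prime) (hodd : p ≠ 2) (N : ℕ)
    (M : Type) [AddCommGroup M] [Finite M] (hM : ∀ x : M, p ^ N • x = 0) :
    ∃ (A : Type) (_ : CommRing A) (_ : Finite A),
      Nonempty (Aˣ ≃* Multiplicative (ZMod (p - 1)) ×
        (Multiplicative (ZMod (p ^ N)) × Multiplicative M)) := by
  have : NeZero (p ^ (N + 1)) := ⟨pow_ne_zero _ hp.ne_zero⟩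
  let : Module (ZMod (p ^ (N + 1))) M := AddCommGroup.zmodModule (by
    intro x; rw [pow_succ', mul_smul, hM, smul_zero])
  let : Module (ZMod (p ^ (N + 1)))ᵐᵒᵖ M :=
    Module.compHom M ((RingHom.id (ZMod (p ^ (N + 1)))).fromOpposite fun _ _ => mul_comm _ _)
  have : IsCentralScalar (ZMod (p ^ (N + 1))) M := ⟨fun _ _ => rfl⟩
  obtain ⟨e⟩ := zmod_units_equiv p hp hodd N
  refine ⟨TrivSqZeroExt (ZMod (p ^ (N + 1))) M, inferInstance,
    inferInstanceAs (Finite (ZMod (p ^ (N + 1)) × M)), ⟨?_⟩⟩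
  exact ((MulEquiv.ofBijective _ (tszUnits_bij (ZMod (p ^ (N + 1))) M)).symm.trans
    (e.prodCongr (MulEquiv.refl _))).trans MulEquiv.prodAssoc

/-- For every odd prime `p` and every finite abelian `p`-group `P`, there
is a finite commutative ring `A` with `A* ≅ ℤ/(p-1)ℤ × P`. -/
theorem stmt17 (p : ℕ) (hp : p.Prime) (hodd : p ≠ 2)
    (P : Type*) [CommGroup P] [Finite P] (hP : IsPGroup p P) :
    ∃ (A : Type) (_ : CommRing A) (_ : Finite A),
      Nonempty (Aˣ ≃* Multiplicative (ZMod (p - 1)) × P) := by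
  classical
  have : Fact p.Prime := ⟨hp⟩
  obtain ⟨ι, _, n, hn, ⟨f⟩⟩ := CommGroup.equiv_prod_multiplicative_zmod_of_finite P
  have : ∀ i, NeZero (n i) := fun i => ⟨by have := hn i; omega⟩
  have hpow : ∀ i, ∃ e, n i = p ^ e := by
    intro i
    have h1 : IsPGroup p (Multiplicative (ZMod (n i))) :=
      hP.of_surjective ((Pi.evalMonoidHom _ i).comp f.toMonoidHom)
        ((Function.surjective_eval i).comp f.surjective)
    obtain ⟨e, he⟩ := IsPGroup.iff_card.1 h1
    exact ⟨e, by simpa using he⟩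
  choose e he using hpow
  rcases isEmpty_or_nonempty ι with hι | hι
  · obtain ⟨A, i1, i2, ⟨g⟩⟩ := ring_of_module p hp hodd 0 Unit (fun _ => rfl)
    have : Subsingleton P := f.injective.subsingleton
    have : Unique P := { default := 1, uniq := fun a => Subsingleton.elim _ _ }
    have : Subsingleton (ZMod (p ^ 0)) := by rw [pow_zero]; infer_instance
    have : Unique (Multiplicative (ZMod (p ^ 0)) × Multiplicative Unit) := 
      { default := 1, uniq := fun a => Prod.ext (Subsingleton.elim (α := ZMod (p ^ 0)) _ _) rfl }
    exact ⟨A, i1, i2, ⟨g.trans ((MulEquiv.refl _).prodCongr MulEquiv.ofUnique)⟩⟩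
  · obtain ⟨i, hi⟩ := Finite.exists_max e
    obtain ⟨A, i1, i2, ⟨g⟩⟩ := ring_of_module p hp hodd (e i)
      (∀ j : {j // j ≠ i}, ZMod (n j)) (by
        intro x
        funext j
        have : n j ∣ p ^ e i := by rw [he]; exact pow_dvd_pow _ (hi _)
        have h0 : ((p ^ e i : ℕ) : ZMod (n j)) = 0 := (ZMod.natCast_eq_zero_iff _ _).2 this
        rw [Pi.smul_apply, nsmul_eq_mul, h0, zero_mul]; rfl)
    rw [← he i] at g
    have s : (∀ j, Multiplicative (ZMod (n j))) ≃*
        Multiplicative (ZMod (n i)) × Multiplicative (∀ j : {j // j ≠ i}, ZMod (n j)) :=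
      { Equiv.piSplitAt i (fun j => Multiplicative (ZMod (n j))) with
        map_mul' := fun _ _ => rfl }
    exact ⟨A, i1, i2, ⟨g.trans ((MulEquiv.refl _).prodCongr (f.trans s).symm)⟩⟩
end

section
/- Let a₀ ≥ 2 and R = (ℤ/2^{a₀+1}ℤ)[t]/(f(t)) with f monic of degree λ irreducible mod 2. Then 1 + 2R ≅ ℤ/2ℤ × ℤ/2^{a₀−1}ℤ × (ℤ/2^{a₀}ℤ)^{λ−1}. -/
/-- The ring `R = (ℤ/2^{a₀+1}ℤ)[t]/(f(t))`. -/
abbrev FuchsR2 (a0 : ℕ) (f : Polynomial (ZMod (2 ^ (a0 + 1)))) :=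
  Polynomial (ZMod (2 ^ (a0 + 1))) ⧸ Ideal.span {f}

theorem aux_pi (b c k : ℕ) (E : Option (Option (Fin k)) → ℕ) (h0 : E none = 2) (h1 : E (some none) = b)
    (h2 : ∀ j, E (some (some j)) = c) :
    Nonempty ((∀ i, ZMod (E i)) ≃+ (ZMod 2 × ZMod b × (Fin k → ZMod c))) := by
  have : E = fun o => match o with
    | none => 2
    | some none => b
    | some (some _) => c := by
    funext o
    rcases o with _ | _ | j
    · exact h0
    · exact h1
    · exact h2 j
  subst this
  exact ⟨{ toFun := fun h => (h none, h (some none), fun j => h (some (some j)))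
           invFun := fun p o => match o with
             | none => p.1
             | some none => p.2.1
             | some (some j) => p.2.2 j
           left_inv := by
             intro h; funext o
             rcases o with _ | _ | j <;> rfl
           right_inv := by intro p; rfl
           map_add' := by intro x y; rfl }⟩

theorem aux_comb {ι : Type*} [Fintype ι] [DecidableEq ι] (a l : ℕ) (e : ι → ℕ) (ha : 2 ≤ a) 
    (he1 : ∀ i, e i ≤ a) (hs : ∑ i, e i = a * l) (hc : Fintype.card ι ≤ l + 1) (i0 : ι) (h0 : e i0 = 1) :
    Fintype.card ι = l + 1 ∧ ∃ i1, i1 ≠ i0 ∧ e i1 = a - 1 ∧ ∀ j, j ≠ i0 → j ≠ i1 → e j = a := by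
  have hsum : ∑ i ∈ Finset.univ.erase i0, e i + 1 = a * l := by
    rw [← hs, ← Finset.sum_erase_add _ _ (Finset.mem_univ i0), h0]
  have hcard : (Finset.univ.erase i0).card + 1 = Fintype.card ι :=
    Finset.card_erase_add_one (Finset.mem_univ i0)
  have hd : ∑ i ∈ Finset.univ.erase i0, (a - e i) + ∑ i ∈ Finset.univ.erase i0, e i
      = (Finset.univ.erase i0).card * a := by
    rw [← Finset.sum_add_distrib, Finset.sum_congr rfl (fun i _ => Nat.sub_add_cancel (he1 i))]
    simp
  have hk : (Finset.univ.erase i0).card = l := by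
    generalize (Finset.univ.erase i0).card = m at *
    have : l ≤ m := by
      by_contra hlt
      push Not at hlt
      have : (m + 1) * a ≤ l * a := Nat.mul_le_mul_right a hlt
      have h4 := Nat.zero_le (∑ i ∈ Finset.univ.erase i0, (a - e i))
      generalize ∑ i ∈ Finset.univ.erase i0, (a - e i) = D at *
      generalize ∑ i ∈ Finset.univ.erase i0, e i = S at *
      nlinarith
    omega
  rw [hk] at hcard hd
  have hd1 : ∑ i ∈ Finset.univ.erase i0, (a - e i) = 1 := by
    rw [mul_comm l a] at hd; omega
  refine ⟨hcard.symm, ?_⟩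
  obtain ⟨i1, hi1, hne⟩ := Finset.exists_ne_zero_of_sum_ne_zero (by rw [hd1]; exact one_ne_zero)
  rw [← Finset.sum_erase_add _ _ hi1] at hd1
  have hz : ∑ x ∈ (Finset.univ.erase i0).erase i1, (a - e x) = 0 := by omega
  rw [Finset.sum_eq_zero_iff] at hz
  refine ⟨i1, (Finset.mem_erase.1 hi1).1, ?_, ?_⟩
  · omega
  · intro j hj0 hj1
    have := hz j (by simp [hj0, hj1])
    have := he1 j
    omega

theorem aux_grp (G : Type) [AddCommGroup G] [Finite G] (a l : ℕ) (ha : 2 ≤ a) (hl : 1 ≤ l)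
    (hG : Nat.card G = 2 ^ (a * l)) (hexp : ∀ g : G, 2 ^ a • g = 0)
    (htor : Nat.card {g : G // 2 • g = 0} ≤ 2 ^ (l + 1))
    (hm : ∃ g : G, 2 • g = 0 ∧ ∀ h : G, 2 • h ≠ g) :
    Nonempty (G ≃+ (ZMod 2 × ZMod (2 ^ (a - 1)) × (Fin (l - 1) → ZMod (2 ^ a)))) := by
  classical
  obtain ⟨ι, _, n, hn, ⟨φ'⟩⟩ := AddCommGroup.equiv_directSum_zmod_of_finite' G
  let φ : G ≃+ (∀ i, ZMod (n i)) := φ'.trans (DirectSum.addEquivProd _)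
  have hdvd : ∀ i, n i ∣ 2 ^ a := by
    intro i
    have h1 := hexp (φ.symm (Pi.single i 1))
    rw [← map_nsmul, map_eq_zero_iff _ φ.symm.injective] at h1
    have h2 := congrFun h1 i
    simp only [Pi.smul_apply, Pi.single_eq_same, Pi.zero_apply, nsmul_eq_mul, mul_one] at h2
    exact (ZMod.natCast_eq_zero_iff _ _).1 h2
  have hex : ∀ i, ∃ k, k ≤ a ∧ n i = 2 ^ k := fun i => (Nat.dvd_prime_pow Nat.prime_two).1 (hdvd i)
  choose e hea hen using hex
  obtain rfl : n = fun i => 2 ^ e i := funext hen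
  have he0 : ∀ i, e i ≠ 0 := by
    intro i h
    have := hn (i := i)
    simp [h] at this
  have hs : ∑ i, e i = a * l := by
    have h1 := Nat.card_congr φ.toEquiv
    rw [hG, Nat.card_pi] at h1
    simp only [Nat.card_zmod, Finset.prod_pow_eq_pow_sum] at h1
    exact (Nat.pow_right_injective le_rfl h1).symm
  have hpow : ∀ i, 2 ^ e i = 2 * 2 ^ (e i - 1) := by
    intro i
    rw [← pow_succ', Nat.sub_add_cancel (Nat.pos_of_ne_zero (he0 i))]
  have hhalf : ∀ i, (2:ℕ) • (((2 ^ (e i - 1) : ℕ)) : ZMod (2 ^ e i)) = 0 := by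
    intro i
    rw [nsmul_eq_mul, ← Nat.cast_mul, ← hpow, ZMod.natCast_self]
  have hhalf0 : ∀ i, (((2 ^ (e i - 1) : ℕ)) : ZMod (2 ^ e i)) ≠ 0 := by
    intro i h
    rw [ZMod.natCast_eq_zero_iff] at h
    have := (Nat.pow_dvd_pow_iff_le_right (le_refl 2)).1 h
    have := he0 i
    omega
  have hc : Fintype.card ι ≤ l + 1 := by
    let F : (ι → Bool) → {g : G // 2 • g = 0} := fun s =>
      ⟨φ.symm (fun i => if s i then ((2 ^ (e i - 1) : ℕ) : ZMod (2 ^ e i)) else 0), by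
        rw [← map_nsmul, map_eq_zero_iff _ φ.symm.injective]
        funext i
        simp only [Pi.smul_apply, Pi.zero_apply]
        split_ifs
        · exact hhalf i
        · simp⟩
    have hF : Function.Injective F := by
      intro s t hst
      have h1 := φ.symm.injective (congrArg Subtype.val hst)
      funext i
      have h2 := congrFun h1 i
      have := hhalf0 i
      cases hs : s i <;> cases ht : t i <;> simp only [hs, ht] at h2 ⊢
      · exact absurd h2.symm this
      · exact absurd h2 this
    have h1 := (Nat.card_le_card_of_injective F hF).trans htor
    rw [Nat.card_eq_fintype_card, Fintype.card_fun, Fintype.card_bool] at h1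
    exact (Nat.pow_le_pow_iff_right (by norm_num)).1 h1
  have hi0 : ∃ i0, e i0 = 1 := by
    by_contra hno
    push Not at hno
    obtain ⟨g, hg, hgn⟩ := hm
    have h1 : ∀ i, ∃ y : ZMod (2 ^ e i), 2 • y = φ g i := by
      intro i
      have h2 : 2 • φ g i = 0 := by
        rw [← Pi.smul_apply, ← map_nsmul, hg, map_zero]; rfl
      obtain ⟨m, hm⟩ := ZMod.natCast_zmod_surjective (φ g i)
      rw [← hm, nsmul_eq_mul, ← Nat.cast_mul, ZMod.natCast_eq_zero_iff] at h2
      replace h2 : 2 ^ e i ∣ 2 * m := h2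
      rw [hpow] at h2
      have h3 := Nat.dvd_of_mul_dvd_mul_left (by norm_num) h2
      obtain ⟨c, rfl⟩ : 2 ∣ m := (dvd_pow_self 2 (by have := hno i; have := he0 i; omega)).trans h3
      exact ⟨c, by rw [← hm]; simp⟩
    choose y hy using h1
    refine hgn (φ.symm y) ?_
    rw [← map_nsmul, AddEquiv.symm_apply_eq]
    funext i
    exact hy i
  obtain ⟨i0, hi0⟩ := hi0
  obtain ⟨hcard, i1, hne, hi1, hrest⟩ := aux_comb a l e ha hea hs hc i0 hi0
  have hσ : ∃ σ : Option (Option (Fin (l-1))) ≃ ι, σ none = i0 ∧ σ (some none) = i1 := by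
    let τ : Option (Option (Fin (l-1))) ≃ ι := Fintype.equivOfCardEq (by simp; omega)
    refine ⟨(τ.trans (Equiv.swap (τ none) i0)).trans
      (Equiv.swap (Equiv.swap (τ none) i0 (τ (some none))) i1), ?_, ?_⟩
    · simp only [Equiv.trans_apply, Equiv.swap_apply_left]
      apply Equiv.swap_apply_of_ne_of_ne _ hne.symm
      intro h
      have : Equiv.swap (τ none) i0 (τ none) = Equiv.swap (τ none) i0 (τ (some none)) := by
        rw [← h]; simp
      simpa using τ.injective ((Equiv.swap (τ none) i0).injective this)
    · simp
  obtain ⟨σ, hσ0, hσ1⟩ := hσ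
  obtain ⟨ψ⟩ := aux_pi (2 ^ (a-1)) (2 ^ a) (l-1) (fun o => 2 ^ e (σ o)) (by simp [hσ0, hi0])
    (by simp [hσ1, hi1]) (by
      intro j
      have := hrest (σ (some (some j))) (by rw [← hσ0]; simp) (by rw [← hσ1]; simp)
      simp [this])
  let χ : (∀ i, ZMod (2 ^ e i)) ≃+ (∀ o, ZMod (2 ^ e (σ o))) :=
    { Equiv.piCongrLeft' (fun i => ZMod (2 ^ e i)) σ.symm with
      map_add' := by intro x y; rfl }
  exact ⟨(φ.trans χ).trans ψ⟩

theorem aux_ring (R : Type) [CommRing R] [Finite R] (a l : ℕ) (ha : 2 ≤ a) (hl : 1 ≤ l)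
    (h2 : (2 : R) ^ (a + 1) = 0) (hp : (Ideal.span {(2 : R)}).IsPrime)
    (hR : Nat.card R = 2 ^ ((a + 1) * l)) (hQ : Nat.card (R ⧸ Ideal.span {(2 : R)}) = 2 ^ l)
    (hker : ∀ y : R, 4 * y = 0 → y ∈ Ideal.span {(2 : R) ^ (a - 1)})
    (U : Subgroup Rˣ) (hU : ∀ u : Rˣ, u ∈ U ↔ (u : R) - 1 ∈ Ideal.span {(2 : R)}) :
    Nonempty (U ≃* Multiplicative
      (ZMod 2 × ZMod (2 ^ (a - 1)) × (Fin (l - 1) → ZMod (2 ^ a)))) := by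
  have hnil : ∀ x ∈ Ideal.span {(2 : R)}, IsNilpotent x := by
    intro x hx
    obtain ⟨c, rfl⟩ := Ideal.mem_span_singleton.1 hx
    exact ⟨a + 1, by rw [mul_pow, h2, zero_mul]⟩
  have hI : Nat.card (Ideal.span {(2 : R)}) = 2 ^ (a * l) := by
    have := Submodule.card_eq_card_quotient_mul_card (Ideal.span {(2 : R)})
    rw [hR, hQ, add_mul, one_mul, pow_add] at this
    exact (Nat.eq_of_mul_eq_mul_right (by positivity) this).symm
  have h4 : (2 : R) ∉ Ideal.span {(4 : R)} := by
    intro h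
    obtain ⟨c, hc⟩ := Ideal.mem_span_singleton.1 h
    have hu := (hnil (2 * -c) (Ideal.mem_span_singleton.2 ⟨_, rfl⟩)).isUnit_add_one
    have h0 : (2 : R) = 0 := by
      rw [← hu.mul_left_eq_zero]
      linear_combination hc
    rw [h0] at hI
    have : Nat.card (Ideal.span {(0 : R)}) = 1 := by simp
    rw [this] at hI
    have h1 : 1 < 2 ^ (a * l) := Nat.one_lt_two_pow (by positivity)
    omega
  have hcard : Nat.card U = 2 ^ (a * l) := by
    rw [← hI]
    refine Nat.card_congr (Equiv.ofBijective
      (fun u : U => (⟨((u : Rˣ) : R) - 1, (hU u).1 u.2⟩ : Ideal.span {(2 : R)})) ⟨?_, ?_⟩)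
    · intro u v huv
      have := congrArg Subtype.val huv
      simp only [sub_left_inj] at this
      exact Subtype.ext (Units.ext this)
    · rintro ⟨x, hx⟩
      obtain ⟨u, hu⟩ := (hnil x hx).isUnit_add_one
      exact ⟨⟨u, (hU u).2 (by rw [hu]; simpa using hx)⟩, by simp [hu]⟩
  have hexp : ∀ (u : R), u - 1 ∈ Ideal.span {(2 : R)} → ∀ k, u ^ 2 ^ k - 1 ∈ Ideal.span {(2 : R) ^ (k + 1)} := by
    intro u hu k
    induction k with
    | zero => simpa using hu
    | succ k ih =>
      obtain ⟨c, hc⟩ := Ideal.mem_span_singleton.1 ih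
      have hc' : u ^ 2 ^ k = 1 + 2 ^ (k + 1) * c := by rw [← hc]; ring
      rw [pow_succ 2 k, pow_mul, hc', Ideal.mem_span_singleton]
      exact ⟨c + 2 ^ k * c ^ 2, by ring⟩
  have hprod : ∀ x : R, x * (x + 1) ∈ Ideal.span {(2 : R) ^ (a - 1)} →
      x ∈ Ideal.span {(2 : R) ^ (a - 1)} ∨ x + 1 ∈ Ideal.span {(2 : R) ^ (a - 1)} := by
    intro x hx
    have hle : Ideal.span {(2 : R) ^ (a - 1)} ≤ Ideal.span {(2 : R)} := by
      rw [Ideal.span_singleton_le_span_singleton]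
      exact dvd_pow_self _ (by omega)
    rcases hp.mem_or_mem (hle hx) with h | h
    · left
      have hu := (hnil _ h).isUnit_add_one
      rwa [Ideal.mul_unit_mem_iff_mem _ hu] at hx
    · right
      have hu : IsUnit x := by
        have := (hnil _ ((Ideal.neg_mem_iff _).2 h)).isUnit_add_one
        have h5 : -(x + 1) + 1 = -x := by ring
        rw [h5] at this
        simpa using this
      rwa [Ideal.unit_mul_mem_iff_mem _ hu] at hx
  -- elements of order two
  have htor : ∀ u : Rˣ, u ∈ U → u ^ 2 = 1 →
      ∃ (b : Bool) (c : R), (u : R) = (if b then 1 else -1) + 2 ^ a * c := by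
    intro u hu hu2
    obtain ⟨x, hx⟩ := Ideal.mem_span_singleton.1 ((hU u).1 hu)
    have hx' : (u : R) = 1 + 2 * x := by rw [← hx]; ring
    have h6 : (u : R) ^ 2 = 1 := by rw [← Units.val_pow_eq_pow_val, hu2]; rfl
    have h7 : 4 * (x * (x + 1)) = 0 := by
      rw [hx'] at h6
      linear_combination h6
    have h8 : (2 : R) ^ a = 2 * 2 ^ (a - 1) := by
      rw [← pow_succ', Nat.sub_add_cancel (by omega)]
    rcases hprod x (hker _ h7) with h | h
    · obtain ⟨c, hc⟩ := Ideal.mem_span_singleton.1 h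
      exact ⟨true, c, by rw [hx', h8, if_pos rfl]; linear_combination 2 * hc⟩
    · obtain ⟨c, hc⟩ := Ideal.mem_span_singleton.1 h
      exact ⟨false, c, by rw [hx', h8, if_neg (by simp)]; linear_combination 2 * hc⟩
  have hsur : ∃ s : R ⧸ Ideal.span {(2 : R)} → R, ∀ c, 2 ^ a * s (Ideal.Quotient.mk _ c) = 2 ^ a * c := by
    refine ⟨fun q => Quotient.out q, fun c => ?_⟩
    have : (Ideal.Quotient.mk (Ideal.span {(2 : R)})) (Quotient.out (Ideal.Quotient.mk (Ideal.span {(2 : R)}) c))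
        = Ideal.Quotient.mk _ c := Quotient.out_eq _
    rw [Ideal.Quotient.eq] at this
    obtain ⟨d, hd⟩ := Ideal.mem_span_singleton.1 this
    rw [← sub_eq_zero, ← mul_sub, hd, ← mul_assoc, ← pow_succ, h2, zero_mul]
  obtain ⟨s, hs⟩ := hsur
  have hT : Nat.card {g : Additive U // 2 • g = 0} ≤ 2 ^ (l + 1) := by
    have : Finite (R ⧸ Ideal.span {(2 : R)}) := Quotient.finite _
    have hb : Nat.card (Bool × (R ⧸ Ideal.span {(2 : R)})) = 2 ^ (l + 1) := by
      rw [Nat.card_prod, hQ]; simp [pow_succ, mul_comm]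
    rw [← hb]
    have key : ∀ g : {g : Additive U // 2 • g = 0}, ∃ q : Bool × (R ⧸ Ideal.span {(2 : R)}),
        (((g.1.toMul : U) : Rˣ) : R) = (if q.1 then 1 else -1) + 2 ^ a * s q.2 := by
      rintro ⟨g, hg⟩
      have hg2 : ((g.toMul : U) : Rˣ) ^ 2 = 1 := by
        have : g.toMul ^ 2 = 1 := hg
        exact_mod_cast congrArg Subtype.val this
      obtain ⟨b, c, hbc⟩ := htor _ g.toMul.2 hg2
      exact ⟨(b, Ideal.Quotient.mk _ c), by rw [hs]; exact hbc⟩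
    choose F hF using key
    refine Nat.card_le_card_of_injective F ?_
    intro g h hgh
    have h9 := hF g
    rw [hgh, ← hF h] at h9
    exact Subtype.ext (Additive.toMul.injective (Subtype.ext (Units.ext h9)))
  have hmU : (-1 : Rˣ) ∈ U := by
    rw [hU, Ideal.mem_span_singleton]
    exact ⟨-1, by push_cast; ring⟩
  refine (aux_grp (Additive U) a l ha hl hcard ?_ hT ?_).map (fun ψ => AddEquiv.toMultiplicativeRight ψ)
  · intro g
    have := hexp _ ((hU _).1 g.toMul.2) a
    rw [h2, Ideal.mem_span_singleton, zero_dvd_iff, sub_eq_zero] at this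
    have h10 : g.toMul ^ 2 ^ a = 1 := Subtype.ext (Units.ext (by simpa using this))
    exact h10
  · refine ⟨Additive.ofMul ⟨-1, hmU⟩, ?_, ?_⟩
    · have : (⟨-1, hmU⟩ : U) ^ 2 = 1 := Subtype.ext (by simp)
      exact this
    · intro h hh
      have h11 : h.toMul ^ 2 = (⟨-1, hmU⟩ : U) := hh
      have h12 : (((h.toMul : U) : Rˣ) : R) ^ 2 = -1 := by
        have := congrArg (fun u : U => ((u : Rˣ) : R)) h11
        simpa using this
      have h13 := hexp _ ((hU _).1 h.toMul.2) 1
      rw [pow_one, h12, Ideal.mem_span_singleton] at h13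
      apply h4
      rw [Ideal.mem_span_singleton]
      obtain ⟨c, hc⟩ := h13
      exact ⟨-c, by linear_combination -hc⟩

theorem stmt19 (a0 lam : ℕ) (ha0 : 2 ≤ a0) (hlam : 1 ≤ lam)
    (f : Polynomial (ZMod (2 ^ (a0 + 1)))) (hf : f.Monic) (hdeg : f.natDegree = lam)
    (hirr : Irreducible
      (f.map (ZMod.castHom (dvd_pow_self 2 (Nat.succ_ne_zero a0)) (ZMod 2))))
    (U : Subgroup (FuchsR2 a0 f)ˣ)
    (hU : ∀ u : (FuchsR2 a0 f)ˣ,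
      u ∈ U ↔ (u : FuchsR2 a0 f) - 1 ∈ Ideal.span {(2 : FuchsR2 a0 f)}) :
    Nonempty (U ≃* Multiplicative
      (ZMod 2 × ZMod (2 ^ (a0 - 1)) × (Fin (lam - 1) → ZMod (2 ^ a0)))) := by
  let π := ZMod.castHom (dvd_pow_self 2 (Nat.succ_ne_zero a0)) (ZMod 2)
  have hπ : Function.Surjective π := ZMod.castHom_surjective _
  let B : Module.Basis (Fin f.natDegree) (ZMod (2 ^ (a0 + 1))) (FuchsR2 a0 f) :=
    (AdjoinRoot.powerBasis' hf).basis
  have : Finite (FuchsR2 a0 f) := Finite.of_equiv _ B.equivFun.symm.toEquiv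
  have hR : Nat.card (FuchsR2 a0 f) = 2 ^ ((a0 + 1) * lam) := by
    rw [Nat.card_congr B.equivFun.toEquiv]
    simp [hdeg, pow_mul]
  have h2 : (2 : FuchsR2 a0 f) ^ (a0 + 1) = 0 := by
    have h : ((2 ^ (a0 + 1) : ℕ) : ZMod (2 ^ (a0 + 1))) = 0 := ZMod.natCast_self _
    have h' := congrArg (algebraMap (ZMod (2 ^ (a0 + 1))) (FuchsR2 a0 f)) h
    rw [map_natCast, map_zero] at h'
    exact_mod_cast h'
  have hkerπ : ∀ z, π z = 0 → ∃ w, z = 2 * w := by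
    intro z hz
    obtain ⟨m, rfl⟩ := ZMod.natCast_zmod_surjective z
    rw [map_natCast, ZMod.natCast_eq_zero_iff] at hz
    obtain ⟨c, rfl⟩ := hz
    exact ⟨c, by push_cast; rfl⟩
  have hker : ∀ y : FuchsR2 a0 f, 4 * y = 0 → y ∈ Ideal.span {(2 : FuchsR2 a0 f) ^ (a0 - 1)} := by
    intro y hy
    have h1 : ∀ i, ∃ d : ZMod (2 ^ (a0 + 1)), B.equivFun y i = 2 ^ (a0 - 1) * d := by
      intro i
      have h3 : (4 : ℕ) • B.equivFun y i = 0 := by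
        rw [← Pi.smul_apply, ← map_nsmul, nsmul_eq_mul]
        have : ((4 : ℕ) : FuchsR2 a0 f) * y = 0 := by exact_mod_cast hy
        rw [this, map_zero]; rfl
      obtain ⟨m, hm⟩ := ZMod.natCast_zmod_surjective (B.equivFun y i)
      rw [← hm, nsmul_eq_mul, ← Nat.cast_mul, ZMod.natCast_eq_zero_iff] at h3
      have h5 : 2 ^ (a0 + 1) = 4 * 2 ^ (a0 - 1) := by
        obtain ⟨k, rfl⟩ : ∃ k, a0 = k + 1 := ⟨a0 - 1, by omega⟩
        rw [Nat.add_sub_cancel]; ring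
      obtain ⟨c, hc⟩ := h3
      have h6 : m = 2 ^ (a0 - 1) * c := by
        rw [h5, mul_assoc] at hc
        exact Nat.eq_of_mul_eq_mul_left (by norm_num) hc
      exact ⟨c, by rw [← hm, h6]; push_cast; rfl⟩
    choose d hd using h1
    rw [Ideal.mem_span_singleton]
    refine ⟨B.equivFun.symm d, ?_⟩
    apply B.equivFun.injective
    have h7 : (2 : FuchsR2 a0 f) ^ (a0 - 1) * B.equivFun.symm d = (2 ^ (a0 - 1) : ℕ) • B.equivFun.symm d := by
      rw [nsmul_eq_mul]; push_cast; rfl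
    rw [h7, map_nsmul, LinearEquiv.apply_symm_apply]
    funext i
    rw [hd, Pi.smul_apply, nsmul_eq_mul]; push_cast; rfl
  let g := f.map π
  have hg : g.Monic := hf.map π
  have : Fact (Irreducible g) := ⟨hirr⟩
  let Φ : FuchsR2 a0 f →+* AdjoinRoot g := Ideal.Quotient.lift (Ideal.span {f})
    ((AdjoinRoot.mk g).comp (Polynomial.mapRingHom π)) (by
      intro p hp
      obtain ⟨q, rfl⟩ := Ideal.mem_span_singleton.1 hp
      simp only [RingHom.comp_apply, map_mul, Polynomial.coe_mapRingHom]
      change AdjoinRoot.mk g g * _ = 0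
      rw [AdjoinRoot.mk_self, zero_mul])
  have hΦ : ∀ p, Φ (Ideal.Quotient.mk _ p) = AdjoinRoot.mk g (p.map π) := fun p => rfl
  have hΦs : Function.Surjective Φ := by
    intro z
    obtain ⟨q, rfl⟩ := AdjoinRoot.mk_surjective z
    obtain ⟨p, rfl⟩ := Polynomial.map_surjective π hπ q
    exact ⟨_, hΦ p⟩
  have hΦk : RingHom.ker Φ = Ideal.span {(2 : FuchsR2 a0 f)} := by
    apply le_antisymm
    · intro x hx
      obtain ⟨p, rfl⟩ := Ideal.Quotient.mk_surjective x
      rw [RingHom.mem_ker, hΦ, AdjoinRoot.mk_eq_zero] at hx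
      obtain ⟨q, hq⟩ := hx
      obtain ⟨r, rfl⟩ := Polynomial.map_surjective π hπ q
      have h8 : (p - f * r).map π = 0 := by
        rw [Polynomial.map_sub, Polynomial.map_mul, hq, sub_self]
      have h9 : Polynomial.C 2 ∣ p - f * r := by
        rw [Polynomial.C_dvd_iff_dvd_coeff]
        intro i
        have := congrArg (fun q => Polynomial.coeff q i) h8
        simp only [Polynomial.coeff_map, Polynomial.coeff_zero] at this
        exact hkerπ _ this
      obtain ⟨t, ht⟩ := h9
      have h10 : p = f * r + 2 * t := by
        have : (Polynomial.C 2 : Polynomial (ZMod (2 ^ (a0 + 1)))) = 2 := rfl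
        rw [this] at ht
        linear_combination ht
      rw [Ideal.mem_span_singleton]
      refine ⟨Ideal.Quotient.mk _ t, ?_⟩
      have h11 : Ideal.Quotient.mk (Ideal.span {f}) f = 0 :=
        Ideal.Quotient.eq_zero_iff_mem.2 (Ideal.mem_span_singleton_self f)
      rw [h10, map_add, map_mul, map_mul, h11, zero_mul, zero_add, map_ofNat]
    · rw [Ideal.span_singleton_le_iff_mem, RingHom.mem_ker, map_ofNat]
      have : algebraMap (ZMod 2) (AdjoinRoot g) ((2 : ℕ) : ZMod 2) = 0 := by
        rw [ZMod.natCast_self, map_zero]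
      rw [map_natCast] at this
      exact_mod_cast this
  have hp : (Ideal.span {(2 : FuchsR2 a0 f)}).IsPrime := by
    rw [← hΦk]; exact RingHom.ker_isPrime Φ
  have hQ : Nat.card (FuchsR2 a0 f ⧸ Ideal.span {(2 : FuchsR2 a0 f)}) = 2 ^ lam := by
    rw [← hΦk, Nat.card_congr (RingHom.quotientKerEquivOfSurjective hΦs).toEquiv,
      Nat.card_congr (AdjoinRoot.powerBasis' hg).basis.equivFun.toEquiv]
    have : g.natDegree = lam := by rw [← hdeg]; exact hf.natDegree_map π
    simp [this]
  exact aux_ring (FuchsR2 a0 f) a0 lam ha0 hlam h2 hp hR hQ hker U hU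
end
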